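/- Let X be a Peano continuum having a free arc, which is neither an arc nor a circle, possessing at least one maximal free open interval of Type I, and let F be a commutative subsemigroup of C^0(X) consisting of continuous open maps that is sensitive with sensitivity constant c > 0. Set ε = c/7, let δ = δ(ε) ∈ (0, ε/2] be such that any two points of X at positive distance at most δ are joined by an arc of diameter less than ε, and let U_1, …, U_n be arcwise connected open subsets of X with ∪_{i=1}^n U_i = X and diam(U_i) < ε for each i. For f_1, …, f_m ∈ F define S(f_1,…,f_m) = Σ_{i=1}^n d(U_i, ∪_{j=1}^m f_j(U_i)). If f_1, …, f_m ∈ F and there is a free arc A_m ⊆ X which is a jumping arc of {f_1,…,f_m} such that A_m, f_1(A_m), …, f_m(A_m) are contained in a single maximal free open interval of Type I, then there exist a free arc A_{m+1} ⊆ X and f_{m+1} ∈ F such that A_{m+1} is a jumping arc of {f_1,…,f_{m+1}}, the sets A_{m+1}, f_1(A_{m+1}), …, f_{m+1}(A_{m+1}) are contained in a single maximal free open interval of Type I, and S(f_1,…,f_m,f_{m+1}) < S(f_1,…,f_m) − δ. -/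

import Mathlib

open Set Metric Topology

/-- The whole space `X` is an arc, i.e. homeomorphic to `[0,1]`. -/
def SpaceIsArc (X : Type*) [TopologicalSpace X] : Prop :=
  Nonempty (X ≃ₜ Set.Icc (0:ℝ) 1)

/-- The whole space `X` is a circle, i.e. homeomorphic to the unit circle in `ℂ`. -/
def SpaceIsCircle (X : Type*) [TopologicalSpace X] : Prop :=
  Nonempty (X ≃ₜ Metric.sphere (0:ℂ) 1)

/-- A subset `A` is an arc: with the subspace topology it is homeomorphic to `[0,1]`. -/
def IsArc {X : Type*} [TopologicalSpace X] (A : Set X) : Prop :=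
  Nonempty (A ≃ₜ Set.Icc (0:ℝ) 1)

/-- A subset `A` is a circle: with the subspace topology it is homeomorphic to `S¹`. -/
def IsCircleSet {X : Type*} [TopologicalSpace X] (A : Set X) : Prop :=
  Nonempty (A ≃ₜ Metric.sphere (0:ℂ) 1)

/-- `A` is an arc with endpoints `a` and `b`: it is the image of a continuous
injective parametrization of `[0,1]` with `γ 0 = a` and `γ 1 = b`. -/
def IsArcEnds {X : Type*} [TopologicalSpace X] (A : Set X) (a b : X) : Prop :=
  ∃ γ : ℝ → X, ContinuousOn γ (Set.Icc 0 1) ∧ Set.InjOn γ (Set.Icc 0 1) ∧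
    γ '' Set.Icc 0 1 = A ∧ γ 0 = a ∧ γ 1 = b

/-- A free open interval: an open subset homeomorphic to `(0,1)`. -/
def IsFreeOpenInterval {X : Type*} [TopologicalSpace X] (J : Set X) : Prop :=
  IsOpen J ∧ Nonempty (J ≃ₜ Set.Ioo (0:ℝ) 1)

/-- A free arc: the closure of a free open interval, homeomorphic to `[0,1]`. -/
def IsFreeArc {X : Type*} [TopologicalSpace X] (A : Set X) : Prop :=
  ∃ J : Set X, IsFreeOpenInterval J ∧ A = closure J ∧ IsArc A

/-- A maximal free open interval: no free open interval properly contains it. -/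
def IsMaxFreeOpenInterval {X : Type*} [TopologicalSpace X] (J : Set X) : Prop :=
  IsFreeOpenInterval J ∧ ∀ K : Set X, IsFreeOpenInterval K → J ⊆ K → J = K

/-- `x` is an endpoint of the space `X`: every open set containing `x` contains an
open neighborhood of `x` whose boundary is a single point. -/
def IsEndpointOf (X : Type*) [TopologicalSpace X] (x : X) : Prop :=
  ∀ U : Set X, IsOpen U → x ∈ U → ∃ V : Set X, IsOpen V ∧ x ∈ V ∧ V ⊆ U ∧
    ∃ y : X, frontier V = {y}

/-- A maximal free open interval of Type I: its closure is an arc `J ∪ {a,b}` with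
`a, b ∉ J` and at least one of `a, b` an endpoint of `X`. -/
def IsTypeI {X : Type*} [TopologicalSpace X] (J : Set X) : Prop :=
  IsMaxFreeOpenInterval J ∧ ∃ a b : X, a ≠ b ∧ a ∉ J ∧ b ∉ J ∧
    closure J = J ∪ {a, b} ∧ IsArcEnds (closure J) a b ∧
    (IsEndpointOf X a ∨ IsEndpointOf X b)

/-- The model simple triod in the complex plane: three unit segments from the
origin in directions `π/3`, `π`, `5π/3`. -/
noncomputable def triodModel : Set ℂ :=
  ⋃ θ ∈ ({Real.pi / 3, Real.pi, 5 * Real.pi / 3} : Set ℝ),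
    (fun r : ℝ => (r : ℂ) * Complex.exp (θ * Complex.I)) '' Set.Icc (0:ℝ) 1

/-- `A` is a simple triod. -/
def IsSimpleTriod {X : Type*} [TopologicalSpace X] (A : Set X) : Prop :=
  Nonempty (A ≃ₜ triodModel)

/-- `U` contains no simple triod. -/
def ContainsNoTriod {X : Type*} [TopologicalSpace X] (U : Set X) : Prop :=
  ∀ A : Set X, A ⊆ U → ¬ IsSimpleTriod A

/-- The distance between two subsets of a metric space:
`d(S,T) = inf { dist s t | s ∈ S, t ∈ T }`. -/
noncomputable def setDist {X : Type*} [MetricSpace X] (S T : Set X) : ℝ :=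
  sInf (Set.image2 dist S T)

theorem IsPreconnected.exists_mem_frontier {X : Type*} [TopologicalSpace X] {K V : Set X}
    (hK : IsPreconnected K) (hV : IsOpen V) {x y : X} (hx : x ∈ K) (hxV : x ∈ V)
    (hy : y ∈ K) (hyV : y ∉ V) : ∃ z ∈ K, z ∈ frontier V := by
  by_contra! hno
  have hcl : ∀ z ∈ K, z ∉ V → z ∉ closure V := fun z hz hzV hzc ↦
    hno z hz (by rw [hV.frontier_eq]; exact ⟨hzc, hzV⟩)
  obtain ⟨z, -, hzV, hzc⟩ := hK V (closure V)ᶜ hV isClosed_closure.isOpen_compl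
    (fun z hz ↦ or_iff_not_imp_left.2 (hcl z hz)) ⟨x, hx, hxV⟩ ⟨y, hy, hcl y hy hyV⟩
  exact hzc (subset_closure hzV)

/-- An open interval together with an endpoint of `X` in its boundary is open. -/
theorem IsEndpointOf.isOpen_insert {X : Type*} [MetricSpace X] [ConnectedSpace X]
    {J : Set X} {a b : X} (he : IsEndpointOf X a) (hJ : IsOpen J) (hab : a ≠ b)
    (haJ : a ∉ J) (hcl : closure J = J ∪ {a, b})
    (hconn : IsPreconnected (closure J)) : IsOpen (insert a J) := by
  have hr : 0 < dist a b / 2 := half_pos (dist_pos.2 hab)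
  have haC : a ∈ closure J := by simp [hcl]
  have hbC : b ∈ closure J := by simp [hcl]
  have key : ∀ W : Set X, IsOpen W → a ∈ W →
      ∃ V : Set X, IsOpen V ∧ a ∈ V ∧ V ⊆ W ∧ b ∉ V ∧ closure V ⊆ V ∪ J := by
    intro W hW haW
    obtain ⟨V, hV, haV, hVW, y, hy⟩ :=
      he (W ∩ ball a (dist a b / 2)) (hW.inter isOpen_ball) ⟨haW, mem_ball_self hr⟩
    have hbV : b ∉ closure V := fun h ↦ by
      have h1 := closure_ball_subset_closedBall
        (closure_mono (hVW.trans inter_subset_right) h)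
      rw [mem_closedBall, dist_comm] at h1
      linarith
    have hbV' : b ∉ V := fun h ↦ hbV (subset_closure h)
    refine ⟨V, hV, haV, hVW.trans inter_subset_left, hbV', ?_⟩
    obtain ⟨z, hzC, hz⟩ := hconn.exists_mem_frontier hV haC haV hbC hbV'
    have hzy : z = y := by simpa [hy] using hz
    have hyJ : y ∈ J := by
      rw [← hzy]
      rw [hV.frontier_eq] at hz
      rw [hcl] at hzC
      rcases hzC with h | h | h
      · exact h
      · exact absurd (h ▸ haV) hz.2
      · exact absurd (h ▸ hz.1) hbV
    intro x hx
    by_cases hxV : x ∈ V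
    · exact Or.inl hxV
    · have : x ∈ frontier V := by rw [hV.frontier_eq]; exact ⟨hx, hxV⟩
      rw [hy] at this
      exact Or.inr (this ▸ hyJ)
  obtain ⟨V, hV, haV, -, hbV, hVcl⟩ := key univ isOpen_univ trivial
  have hVJ : V ⊆ insert a J := by
    intro d hd
    by_contra hdJ
    rw [mem_insert_iff, not_or] at hdJ
    obtain ⟨V', hV', haV', hdV', -, hVcl'⟩ := key {d}ᶜ isOpen_compl_singleton (Ne.symm hdJ.1)
    have hclosed : (V \ V') \ J = closure V ∩ V'ᶜ ∩ Jᶜ := by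
      ext x
      constructor
      · exact fun h ↦ ⟨⟨subset_closure h.1.1, h.1.2⟩, h.2⟩
      · exact fun h ↦ ⟨⟨(hVcl h.1.1).resolve_right h.2, h.1.2⟩, h.2⟩
    have hopen : (V \ V') \ J = V ∩ (closure V')ᶜ ∩ (closure J)ᶜ := by
      ext x
      constructor
      · refine fun h ↦ ⟨⟨h.1.1, fun h' ↦ ?_⟩, fun h' ↦ ?_⟩
        · exact (hVcl' h').elim h.1.2 h.2
        · rw [hcl] at h'
          rcases h' with h' | h' | h'
          · exact h.2 h'
          · exact h.1.2 (h' ▸ haV')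
          · exact hbV (h' ▸ h.1.1)
      · exact fun h ↦ ⟨⟨h.1.1, fun h' ↦ h.1.2 (subset_closure h')⟩,
          fun h' ↦ h.2 (subset_closure h')⟩
    have hclopen : IsClopen ((V \ V') \ J) := by
      constructor
      · rw [hclosed]
        exact (isClosed_closure.inter hV'.isClosed_compl).inter hJ.isClosed_compl
      · rw [hopen]
        exact (hV.inter isClosed_closure.isOpen_compl).inter isClosed_closure.isOpen_compl
    have huniv := hclopen.eq_univ ⟨d, ⟨hd, fun h ↦ hdV' h rfl⟩, hdJ.2⟩
    have : a ∈ (V \ V') \ J := huniv ▸ mem_univ a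
    exact this.1.2 haV'
  have : insert a J = J ∪ V := by
    ext x
    constructor
    · rintro (rfl | h)
      · exact Or.inr haV
      · exact Or.inl h
    · rintro (h | h)
      · exact Or.inr h
      · exact hVJ h
  rw [this]
  exact hJ.union hV

theorem IsArcEnds.symm {X : Type*} [TopologicalSpace X] {A : Set X} {a b : X}
    (h : IsArcEnds A a b) : IsArcEnds A b a := by
  obtain ⟨γ, hc, hi, him, h0, h1⟩ := h
  have hmaps : MapsTo (fun t : ℝ ↦ 1 - t) (Icc 0 1) (Icc 0 1) := fun t ht ↦
    ⟨by linarith [ht.2], by linarith [ht.1]⟩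
  refine ⟨γ ∘ fun t ↦ 1 - t, hc.comp (by fun_prop) hmaps,
    hi.comp (sub_right_injective.injOn) hmaps, ?_, by simp [h1], by simp [h0]⟩
  rw [image_comp]
  simp [him]

/-- A parametrized arc whose proper initial segments are open in the ambient space. -/
structure IsOpenEndedArc {X : Type*} [TopologicalSpace X] (γ : ℝ → X) : Prop where
  continuousOn : ContinuousOn γ (Icc 0 1)
  injOn : InjOn γ (Icc 0 1)
  isOpen_image_Ico : ∀ t ∈ Icc (0 : ℝ) 1, IsOpen (γ '' Ico 0 t)

theorem IsEndpointOf.exists_isOpenEndedArc {X : Type*} [MetricSpace X] [ConnectedSpace X]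
    {J : Set X} {a b : X} (he : IsEndpointOf X a) (hJ : IsOpen J) (hab : a ≠ b)
    (haJ : a ∉ J) (hcl : closure J = J ∪ {a, b})
    (harc : IsArcEnds (closure J) a b) : ∃ γ : ℝ → X, IsOpenEndedArc γ := by
  obtain ⟨γ, hc, hi, him, h0, h1⟩ := harc
  have hop := he.isOpen_insert hJ hab haJ hcl (him ▸ isPreconnected_Icc.image _ hc)
  refine ⟨γ, hc, hi, fun t ht ↦ ?_⟩
  have hclosed : IsClosed (γ '' Icc t 1) :=
    (isCompact_Icc.image_of_continuousOn (hc.mono (Icc_subset_Icc_left ht.1))).isClosed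
  suffices γ '' Ico 0 t = insert a J \ γ '' Icc t 1 by
    rw [this]
    exact hop.sdiff hclosed
  ext x
  constructor
  · rintro ⟨s, hs, rfl⟩
    have hs1 : s ∈ Icc (0 : ℝ) 1 := ⟨hs.1, hs.2.le.trans ht.2⟩
    refine ⟨?_, ?_⟩
    · have hmem : γ s ∈ closure J := him ▸ mem_image_of_mem γ hs1
      rw [hcl] at hmem
      rcases hmem with h | h | h
      · exact Or.inr h
      · exact Or.inl h
      · have := hi hs1 ⟨zero_le_one, le_rfl⟩ (h.trans h1.symm)
        exact absurd (hs.2.trans_le ht.2) this.not_lt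
    · rintro ⟨u, hu, hus⟩
      have := hi ⟨ht.1.trans hu.1, hu.2⟩ hs1 hus
      exact absurd hs.2 (not_lt.2 (this ▸ hu.1))
  · rintro ⟨hx, hxt⟩
    have hmem : x ∈ γ '' Icc 0 1 := by
      rw [him, hcl]
      rcases hx with h | h
      · simp [h]
      · exact Or.inl h
    obtain ⟨s, hs, rfl⟩ := hmem
    refine ⟨s, ⟨hs.1, ?_⟩, rfl⟩
    by_contra! hts
    exact hxt ⟨s, ⟨hts, hs.2⟩, rfl⟩

theorem IsTypeI.exists_isOpenEndedArc {X : Type*} [MetricSpace X] [ConnectedSpace X]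
    {J : Set X} (hJ : IsTypeI J) : ∃ γ : ℝ → X, IsOpenEndedArc γ := by
  obtain ⟨hmax, a, b, hab, ha, hb, hcl, harc, he | he⟩ := hJ
  · exact he.exists_isOpenEndedArc hmax.1.1 hab ha hcl harc
  · exact he.exists_isOpenEndedArc hmax.1.1 hab.symm hb (by rw [hcl, pair_comm]) harc.symm

theorem IsOpenEndedArc.isOpen_image_Ioo {X : Type*} [TopologicalSpace X] [T2Space X] {γ : ℝ → X}
    (hγ : IsOpenEndedArc γ) {u v : ℝ} (hu : 0 ≤ u) (hv : v ≤ 1) : IsOpen (γ '' Ioo u v) := by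
  rcases le_or_gt v u with huv | huv
  · simp [Ioo_eq_empty_of_le huv]
  have hclosed : IsClosed (γ '' Icc 0 u) := (isCompact_Icc.image_of_continuousOn
    (hγ.continuousOn.mono (Icc_subset_Icc_right (huv.le.trans hv)))).isClosed
  have : Ioo u v = Ico 0 v \ Icc 0 u := by
    ext x
    simp only [mem_Ioo, mem_sdiff, mem_Ico, mem_Icc, not_and, not_le]
    exact ⟨fun h ↦ ⟨⟨hu.trans h.1.le, h.2⟩, fun _ ↦ h.1⟩, fun h ↦ ⟨h.2 h.1.1, h.1.2⟩⟩
  have hsub : Icc 0 u ⊆ Ico 0 v := Icc_subset_Ico_right huv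
  have hinj : InjOn γ (Ico 0 v) := hγ.injOn.mono
    (Ico_subset_Icc_self.trans (Icc_subset_Icc_right hv))
  rw [this, hinj.image_sdiff_subset hsub]
  exact (hγ.isOpen_image_Ico v ⟨hu.trans huv.le, hv⟩).sdiff hclosed

/-- A continuous open self-map of a continuum that is not an arc is injective on every
arc whose proper initial segments are open. -/
theorem IsOpenEndedArc.injOn_comp {X : Type*} [TopologicalSpace X] [T2Space X]
    [ConnectedSpace X] (harc : ¬ SpaceIsArc X) {γ : ℝ → X} (hγ : IsOpenEndedArc γ)
    {g : X → X} (hg : Continuous g) (hgo : IsOpenMap g) : InjOn (g ∘ γ) (Ico 0 1) := by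
  have hc : ContinuousOn (g ∘ γ) (Icc 0 1) := hg.comp_continuousOn hγ.continuousOn
  have hop : ∀ t ∈ Icc (0 : ℝ) 1, IsOpen ((g ∘ γ) '' Ico 0 t) := fun t ht ↦ by
    rw [image_comp]
    exact hgo _ (hγ.isOpen_image_Ico t ht)
  set h := g ∘ γ
  set T : Set ℝ := {t | t ∈ Ioo (0 : ℝ) 1 ∧ ∃ s ∈ Ico 0 t, h s = h t}
  by_contra hninj
  have hTne : T.Nonempty := by
    simp only [InjOn, not_forall] at hninj
    obtain ⟨s, hs, t, ht, hst, hne⟩ := hninj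
    rcases lt_or_gt_of_ne hne with hlt | hlt
    · exact ⟨t, ⟨hs.1.trans_lt hlt, ht.2⟩, s, ⟨hs.1, hlt⟩, hst⟩
    · exact ⟨s, ⟨ht.1.trans_lt hlt, hs.2⟩, t, ⟨ht.1, hlt⟩, hst.symm⟩
  have hTbdd : BddBelow T := ⟨0, fun t ht ↦ ht.1.1.le⟩
  have hTuniv : ∀ t ∈ T, h '' Ico 0 t = univ := by
    rintro t ⟨ht, s, hs, hst⟩
    have hcl : h '' Ico 0 t = h '' Icc 0 t := by
      refine (image_mono Ico_subset_Icc_self).antisymm ?_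
      rintro _ ⟨u, hu, rfl⟩
      rcases hu.2.eq_or_lt with rfl | hlt
      · exact ⟨s, hs, hst⟩
      · exact ⟨u, ⟨hu.1, hlt⟩, rfl⟩
    have hclopen : IsClopen (h '' Ico 0 t) := by
      refine ⟨?_, hop t ⟨ht.1.le, ht.2.le⟩⟩
      rw [hcl]
      exact (isCompact_Icc.image_of_continuousOn
        (hc.mono (Icc_subset_Icc_right ht.2.le))).isClosed
    exact hclopen.eq_univ ⟨h s, s, hs, rfl⟩
  set τ := sInf T
  obtain ⟨t₁, ht₁⟩ := hTne
  have hτ0 : 0 ≤ τ := le_csInf ⟨t₁, ht₁⟩ fun t ht ↦ ht.1.1.le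
  have hτ1 : τ < 1 := (csInf_le hTbdd ht₁).trans_lt ht₁.1.2
  have hsurj : ∀ x, ∃ s ∈ Icc 0 τ, h s = x := by
    intro x
    have hK : IsCompact (Icc (0 : ℝ) 1 ∩ h ⁻¹' {x}) :=
      isCompact_Icc.of_isClosed_subset
        (hc.preimage_isClosed_of_isClosed isClosed_Icc isClosed_singleton) inter_subset_left
    have hKne : (Icc (0 : ℝ) 1 ∩ h ⁻¹' {x}).Nonempty := by
      obtain ⟨s, hs, hsx⟩ : x ∈ h '' Ico 0 t₁ := hTuniv t₁ ht₁ ▸ mem_univ x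
      exact ⟨s, ⟨hs.1, hs.2.le.trans ht₁.1.2.le⟩, hsx⟩
    obtain ⟨s, ⟨hs, hsx⟩, hmin⟩ := hK.exists_isLeast hKne
    refine ⟨s, ⟨hs.1, le_csInf ⟨t₁, ht₁⟩ fun t ht ↦ ?_⟩, hsx⟩
    obtain ⟨u, hu, hux⟩ : x ∈ h '' Ico 0 t := hTuniv t ht ▸ mem_univ x
    exact (hmin ⟨⟨hu.1, hu.2.le.trans ht.1.2.le⟩, hux⟩).trans hu.2.le
  have hlt : ∀ s t, 0 ≤ s → s < t → t < τ → h s ≠ h t := fun s t hs hst htτ heq ↦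
    htτ.not_ge (csInf_le hTbdd ⟨⟨hs.trans_lt hst, htτ.trans hτ1⟩, s, ⟨hs, hst⟩, heq⟩)
  have hlast : ∀ s, 0 ≤ s → s < τ → h s ≠ h τ := by
    intro s hs hsτ heq
    have hη : (s + τ) / 2 ∈ Icc (0 : ℝ) 1 := ⟨by linarith, by linarith⟩
    have hmem : h '' Ico 0 ((s + τ) / 2) ∈ 𝓝 (h τ) :=
      (hop _ hη).mem_nhds ⟨s, ⟨hs, by linarith⟩, heq⟩
    have hcτ : Filter.Tendsto h (𝓝[<] τ) (𝓝 (h τ)) := by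
      refine (hc τ ⟨hτ0, hτ1.le⟩).mono_left ?_
      rw [← nhdsWithin_Ioo_eq_nhdsLT (hs.trans_lt hsτ)]
      exact nhdsWithin_mono _ fun x hx ↦ ⟨hx.1.le, hx.2.le.trans hτ1.le⟩
    have hnear : Ioo ((s + τ) / 2) τ ∈ 𝓝[<] τ := Ioo_mem_nhdsLT (by linarith)
    obtain ⟨r, ⟨u, hu, hur⟩, hr⟩ := ((hcτ.eventually hmem).and (Filter.eventually_mem_set.2 hnear)).exists
    exact hlt u r hu.1 (hu.2.trans hr.1) hr.2 hur
  have hle : ∀ s t, 0 ≤ s → s < t → t ≤ τ → h s ≠ h t := fun s t hs hst htτ ↦ by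
    rcases htτ.eq_or_lt with rfl | htτ
    · exact hlast s hs hst
    · exact hlt s t hs hst htτ
  have hinj : InjOn h (Icc 0 τ) := by
    intro s hs t ht hst
    by_contra hne
    rcases lt_or_gt_of_ne hne with hlt | hlt
    · exact hle s t hs.1 hlt ht.2 hst
    · exact hle t s ht.1 hlt hs.2 hst.symm
  have hτpos : 0 < τ := by
    refine hτ0.lt_of_ne fun h0 ↦ ?_
    have hall : ∀ x, x = h 0 := fun x ↦ by
      obtain ⟨s, hs, rfl⟩ := hsurj x
      rw [← h0] at hs
      rw [le_antisymm hs.2 hs.1]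
    exact zero_ne_one (hγ.injOn ⟨le_rfl, zero_le_one⟩ ⟨zero_le_one, le_rfl⟩
      ((hall (γ 0)).trans (hall (γ 1)).symm))
  let e : Icc 0 τ ≃ X := Equiv.ofBijective ((Icc 0 τ).domRestrict h)
    ⟨injOn_iff_injective.1 hinj, fun x ↦ by
      obtain ⟨s, hs, hsx⟩ := hsurj x
      exact ⟨⟨s, hs⟩, hsx⟩⟩
  have he : Continuous e := (hc.mono (Icc_subset_Icc_right hτ1.le)).domRestrict
  exact harc ⟨he.homeoOfEquivCompactToT2.symm.trans (iccHomeoI 0 τ hτpos)⟩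

/-- An open set with large diameter and at most two boundary points contains a member of any
cover by small connected open sets. -/
theorem exists_cover_member_subset {X ι : Type*} [MetricSpace X] {V : ι → Set X} {r : ℝ}
    (hconn : ∀ i, IsPreconnected (V i)) (hcover : ⋃ i, V i = univ)
    (hclose : ∀ i, ∀ x ∈ V i, ∀ y ∈ V i, dist x y < r) {W : Set X} {p q : X}
    (hW : IsOpen W) (hcl : closure W ⊆ W ∪ {p, q}) (hWpq : IsPreconnected (W ∪ {p, q}))
    (hr : 0 < r) (hdiam : 4 * r < diam W) : ∃ i, (V i).Nonempty ∧ V i ⊆ W := by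
  by_contra! hno
  have hnear : W ⊆ ball p r ∪ ball q r := by
    intro x hx
    obtain ⟨i, hi⟩ := mem_iUnion.1 (hcover ▸ mem_univ x)
    obtain ⟨y, hy, hyW⟩ := not_subset.1 (hno i ⟨x, hi⟩)
    obtain ⟨z, hz, hzW⟩ := (hconn i).exists_mem_frontier hW hi hx hy hyW
    rw [hW.frontier_eq] at hzW
    have hxz := hclose i x hi z hz
    rcases (hcl hzW.1).resolve_left hzW.2 with rfl | rfl
    · exact Or.inl hxz
    · exact Or.inr hxz
  have hp : p ∈ ball p r := mem_ball_self hr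
  have hq : q ∈ ball q r := mem_ball_self hr
  obtain ⟨z, -, hzp, hzq⟩ := hWpq _ _ isOpen_ball isOpen_ball
    (union_subset hnear (insert_subset (Or.inl hp) (singleton_subset_iff.2 (Or.inr hq))))
    ⟨p, by simp, hp⟩ ⟨q, by simp, hq⟩
  rw [mem_ball] at hzp hzq
  refine hdiam.not_ge (diam_le_of_forall_dist_le (by positivity) fun x hx y hy ↦ ?_)
  have hpq : dist p q ≤ dist z p + dist z q := dist_triangle_left p q z
  have hqp : dist q p = dist p q := dist_comm q p
  rcases hnear hx with hx | hx <;> rcases hnear hy with hy | hy <;>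
    rw [mem_ball] at hx hy
  · linarith [dist_triangle_right x y p]
  · linarith [dist_triangle4 x p q y, dist_comm q y]
  · linarith [dist_triangle4 x q p y, dist_comm p y]
  · linarith [dist_triangle_right x y q]

theorem IsArcEnds.isPreconnected {X : Type*} [TopologicalSpace X] {A : Set X} {a b : X}
    (h : IsArcEnds A a b) : IsPreconnected A := by
  obtain ⟨γ, hc, -, rfl, -⟩ := h
  exact isPreconnected_Icc.image γ hc

theorem isPreconnected_of_isArcEnds {X : Type*} [TopologicalSpace X] {U : Set X}
    (h : ∀ x ∈ U, ∀ y ∈ U, x ≠ y → ∃ A : Set X, A ⊆ U ∧ IsArcEnds A x y) :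
    IsPreconnected U := by
  refine isPreconnected_of_forall_pair fun x hx y hy ↦ ?_
  by_cases hxy : x = y
  · exact ⟨{x}, by simpa using hx, by simp, by simp [hxy], isPreconnected_singleton⟩
  · obtain ⟨A, hAU, hA⟩ := h x hx y hy hxy
    have hpre := hA.isPreconnected
    obtain ⟨γ, -, -, rfl, h0, h1⟩ := hA
    exact ⟨_, hAU, ⟨0, by simp, h0⟩, ⟨1, by simp, h1⟩, hpre⟩

/-- A commuting family of maps cannot carry pieces of every nonempty open subset of `D`
bijectively onto members of a finite collection of sets. -/
theorem not_forall_exists_image_eq {X Y ι : Type*} [TopologicalSpace Y] [T2Space Y]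
    [∀ y : Y, (𝓝[≠] y).NeBot] [Finite ι] (V : ι → Set X) {F : Set (X → X)}
    (hcomm : ∀ f ∈ F, ∀ g ∈ F, f ∘ g = g ∘ f) {φ : Y → X} {D : Set Y} (hD : IsOpen D)
    (hDne : D.Nonempty) (hinj : ∀ f ∈ F, ∀ g ∈ F, InjOn (f ∘ g ∘ φ) D) :
    ¬ ∀ O ⊆ D, IsOpen O → O.Nonempty → ∃ i, ∃ Q ⊆ O, IsOpen Q ∧ Q.Nonempty ∧
      ∃ g ∈ F, (g ∘ φ) '' Q = V i := by
  intro hhit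
  let H : Set Y → Set ι := fun O ↦ {i | ∃ Q ⊆ O, IsOpen Q ∧ Q.Nonempty ∧
      ∃ g ∈ F, (g ∘ φ) '' Q = V i}
  have hmono : ∀ {O O'}, O ⊆ O' → H O ⊆ H O' := fun hOO' i ⟨Q, hQ, h⟩ ↦ ⟨Q, hQ.trans hOO', h⟩
  obtain ⟨O, ⟨hOD, hO, hOne⟩, hmin⟩ := (InvImage.wf H (wellFounded_lt (α := Set ι))).has_min
    {O | O ⊆ D ∧ IsOpen O ∧ O.Nonempty} ⟨D, subset_rfl, hD, hDne⟩
  obtain ⟨i, hi⟩ := hhit O hOD hO hOne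
  have hsmall : ∀ O' ⊆ O, IsOpen O' → O'.Nonempty → i ∈ H O' := by
    intro O' hO'O hO' hne
    by_contra hi'
    exact hmin O' ⟨hO'O.trans hOD, hO', hne⟩
      ((hmono hO'O).ssubset_of_mem_notMem hi hi')
  obtain ⟨Q, hQO, hQ, ⟨z, hz⟩, g, hg, hgQ⟩ := hi
  have hpunct : Q ∩ {z}ᶜ ∈ 𝓝[≠] z :=
    Filter.inter_mem (mem_nhdsWithin_of_mem_nhds (hQ.mem_nhds hz)) self_mem_nhdsWithin
  obtain ⟨w, hw, hwz⟩ := Filter.nonempty_of_mem hpunct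
  obtain ⟨O₁, O₂, hO₁, hO₂, hwO, hzO, hdisj⟩ := t2_separation hwz
  obtain ⟨Q₁, hQ₁, -, -, g₁, hg₁, him₁⟩ :=
    hsmall (Q ∩ O₁) (inter_subset_left.trans hQO) (hQ.inter hO₁) ⟨w, hw, hwO⟩
  obtain ⟨Q₂, hQ₂, -, -, g₂, hg₂, him₂⟩ :=
    hsmall (Q ∩ O₂) (inter_subset_left.trans hQO) (hQ.inter hO₂) ⟨z, hz, hzO⟩
  have lift₁ : ∀ x ∈ Q, ∃ y ∈ Q₁, g₁ (φ y) = g (φ x) := fun x hx ↦ by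
    have : (g ∘ φ) x ∈ (g₁ ∘ φ) '' Q₁ := by rw [him₁, ← hgQ]; exact mem_image_of_mem _ hx
    exact this
  have lift₂ : ∀ x ∈ Q, ∃ y ∈ Q₂, g₂ (φ y) = g (φ x) := fun x hx ↦ by
    have : (g ∘ φ) x ∈ (g₂ ∘ φ) '' Q₂ := by rw [him₂, ← hgQ]; exact mem_image_of_mem _ hx
    exact this
  obtain ⟨u, hu, hgu⟩ := lift₂ z hz
  obtain ⟨v, hv, hgv⟩ := lift₁ u (hQ₂ hu).1
  obtain ⟨u', hu', hgu'⟩ := lift₁ z hz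
  obtain ⟨v', hv', hgv'⟩ := lift₂ u' (hQ₁ hu').1
  have heq : v = v' := by
    refine hinj g₂ hg₂ g₁ hg₁ (hOD (hQO (hQ₁ hv).1)) (hOD (hQO (hQ₂ hv').1)) ?_
    calc g₂ (g₁ (φ v)) = g₂ (g (φ u)) := by rw [hgv]
      _ = g (g₂ (φ u)) := congrFun (hcomm g₂ hg₂ g hg) _
      _ = g (g₁ (φ u')) := by rw [hgu, hgu']
      _ = g₁ (g (φ u')) := congrFun (hcomm g hg g₁ hg₁) _
      _ = g₁ (g₂ (φ v')) := by rw [hgv']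
      _ = g₂ (g₁ (φ v')) := congrFun (hcomm g₁ hg₁ g₂ hg₂) _
  exact hdisj.le_bot ⟨(hQ₁ hv).2, heq ▸ (hQ₂ hv').2⟩

/-- A compact connected metric space that is not an arc but contains an arc with open proper
initial segments carries no sensitive commutative semigroup of continuous open maps. -/
theorem IsOpenEndedArc.not_sensitive {X ι : Type*} [MetricSpace X] [CompactSpace X]
    [ConnectedSpace X] [Finite ι] (harc : ¬ SpaceIsArc X) {γ : ℝ → X} (hγ : IsOpenEndedArc γ)
    {F : Set (X → X)} (hcont : ∀ f ∈ F, Continuous f) (hopen : ∀ f ∈ F, IsOpenMap f)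
    (hsemi : ∀ f ∈ F, ∀ g ∈ F, f ∘ g ∈ F) (hcomm : ∀ f ∈ F, ∀ g ∈ F, f ∘ g = g ∘ f)
    {V : ι → Set X} {r : ℝ} (hr : 0 < r) (hVopen : ∀ i, IsOpen (V i))
    (hVconn : ∀ i, IsPreconnected (V i)) (hVcover : ⋃ i, V i = univ)
    (hVdiam : ∀ i, diam (V i) < r) :
    ¬ ∀ U : Set X, IsOpen U → U.Nonempty → ∃ f ∈ F, 4 * r < diam (f '' U) := by
  intro hsens
  refine not_forall_exists_image_eq V hcomm (φ := γ) (D := Ioo 0 1) isOpen_Ioo (by simp)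
    (fun f hf g hg ↦ ?_) fun O hOD hO hOne ↦ ?_
  · exact (hγ.injOn_comp harc (hcont _ (hsemi f hf g hg)) (hopen _ (hsemi f hf g hg))).mono
      Ioo_subset_Ico_self
  obtain ⟨x, hx⟩ := hOne
  obtain ⟨ρ, hρ, hball⟩ := Metric.isOpen_iff.1 hO x hx
  obtain ⟨u, v, hux, hxv, huv⟩ : ∃ u v, u < x ∧ x < v ∧ Icc u v ⊆ O := by
    refine ⟨x - ρ / 2, x + ρ / 2, by linarith, by linarith, fun y hy ↦ hball ?_⟩
    rw [Real.ball_eq_Ioo]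
    exact ⟨by linarith [hy.1], by linarith [hy.2]⟩
  have huv' : u < v := hux.trans hxv
  have hIcc : Icc u v ⊆ Icc 0 1 := huv.trans (hOD.trans Ioo_subset_Icc_self)
  have hu := hIcc (left_mem_Icc.2 huv'.le)
  have hv := hIcc (right_mem_Icc.2 huv'.le)
  have hUo := hγ.isOpen_image_Ioo hu.1 hv.2
  obtain ⟨g, hg, hdiam⟩ := hsens _ hUo ⟨γ x, x, ⟨hux, hxv⟩, rfl⟩
  rw [← image_comp] at hdiam
  have hc : ContinuousOn (g ∘ γ) (Icc u v) :=
    (hcont g hg).comp_continuousOn (hγ.continuousOn.mono hIcc)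
  have hWo : IsOpen ((g ∘ γ) '' Ioo u v) := by
    rw [image_comp]
    exact hopen g hg _ hUo
  have hIm : (g ∘ γ) '' Icc u v = (g ∘ γ) '' Ioo u v ∪ {(g ∘ γ) u, (g ∘ γ) v} := by
    rw [← image_pair, ← image_union, Ioo_union_both huv'.le]
  obtain ⟨i, hne, hi⟩ := exists_cover_member_subset hVconn hVcover
    (fun i y hy z hz ↦ (dist_le_diam_of_mem (isBounded_of_compactSpace) hy hz).trans_lt (hVdiam i))
    hWo (hIm ▸ closure_minimal (image_mono Ioo_subset_Icc_self)
      (isCompact_Icc.image_of_continuousOn hc).isClosed)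
    (hIm ▸ isPreconnected_Icc.image _ hc) hr hdiam
  have himage : (g ∘ γ) '' (Ioo u v ∩ (g ∘ γ) ⁻¹' V i) = V i := by
    rw [image_inter_preimage, inter_eq_right.2 hi]
  refine ⟨i, Ioo u v ∩ (g ∘ γ) ⁻¹' V i, inter_subset_left.trans (Ioo_subset_Icc_self.trans huv),
    (hc.mono Ioo_subset_Icc_self).isOpen_inter_preimage isOpen_Ioo (hVopen i), ?_, g, hg, himage⟩
  rw [← image_nonempty, himage]
  exact hne

/-- Claim E': inductive step producing a jumping arc for one more
map of `F` while decreasing `S` by more than `δ`, in the case where the relevant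
maximal free open intervals are of Type I. -/
theorem stmt_19 (X : Type*) [MetricSpace X] [CompactSpace X] [ConnectedSpace X]
    [LocallyConnectedSpace X]
    (hfree : ∃ A : Set X, IsFreeArc A)
    (harc : ¬ SpaceIsArc X) (hcirc : ¬ SpaceIsCircle X)
    (hexI : ∃ J : Set X, IsTypeI J)
    (F : Set (X → X))
    (hcont : ∀ f ∈ F, Continuous f)
    (hopen : ∀ f ∈ F, IsOpenMap f)
    (hsemi : ∀ f ∈ F, ∀ g ∈ F, f ∘ g ∈ F)
    (hcomm : ∀ f ∈ F, ∀ g ∈ F, f ∘ g = g ∘ f)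
    (c ε δ : ℝ) (hc : 0 < c)
    (hsens : ∀ U : Set X, IsOpen U → U.Nonempty → ∃ f ∈ F, c < Metric.diam (f '' U))
    (hε : ε = c / 7)
    (hδ0 : 0 < δ) (hδε : δ ≤ ε / 2)
    (hδ : ∀ p q : X, 0 < dist p q → dist p q ≤ δ →
      ∃ B : Set X, IsArcEnds B p q ∧ Metric.diam B < ε)
    (n : ℕ) (U : Fin n → Set X)
    (hUopen : ∀ i, IsOpen (U i))
    (hUarc : ∀ i, ∀ x ∈ U i, ∀ y ∈ U i, x ≠ y → ∃ A : Set X, A ⊆ U i ∧ IsArcEnds A x y)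
    (hUcover : (⋃ i, U i) = Set.univ)
    (hUdiam : ∀ i, Metric.diam (U i) < ε)
    (m : ℕ) (f : Fin m → X → X) (hf : ∀ j, f j ∈ F)
    (A : Set X) (hA : IsFreeArc A)
    (hjump : ∀ j : Fin m, A ∩ (f j '' A) = ∅)
    (J : Set X) (hJ : IsTypeI J)
    (hAJ : A ⊆ J) (hfAJ : ∀ j : Fin m, f j '' A ⊆ J) :
    ∃ A' : Set X, ∃ g ∈ F, IsFreeArc A' ∧
      (∀ j : Fin (m + 1), A' ∩ ((Fin.snoc f g : Fin (m + 1) → X → X) j '' A') = ∅) ∧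
      (∃ K : Set X, IsTypeI K ∧ A' ⊆ K ∧
        ∀ j : Fin (m + 1), (Fin.snoc f g : Fin (m + 1) → X → X) j '' A' ⊆ K) ∧
      (∑ i : Fin n, setDist (U i)
          (⋃ j : Fin (m + 1), (Fin.snoc f g : Fin (m + 1) → X → X) j '' U i)) <
        (∑ i : Fin n, setDist (U i) (⋃ j : Fin m, f j '' U i)) - δ := by
  exfalso
  obtain ⟨γ, hγ⟩ := hJ.exists_isOpenEndedArc
  refine hγ.not_sensitive harc hcont hopen hsemi hcomm (r := ε) (by linarith) hUopen
    (fun i ↦ isPreconnected_of_isArcEnds (hUarc i)) hUcover hUdiam fun V hV hVne ↦ ?_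
  obtain ⟨g, hg, hgV⟩ := hsens V hV hVne
  exact ⟨g, hg, by linarith⟩
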